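/- Let n ≥ 1, r ≥ 1, s ≥ 1, and let F, G : ℂⁿ → ℂⁿ be analytic at 0 with F(x) = x + F_{r+1}(x) + O(‖x‖^{r+2}) and G(x) = x + G_{s+1}(x) + O(‖x‖^{s+2}) as x → 0, where F_{r+1} and G_{s+1} are homogeneous polynomial maps of degrees r+1 and s+1 respectively. Then F(G(x)) − G(F(x)) = DF_{r+1}(x)·G_{s+1}(x) − DG_{s+1}(x)·F_{r+1}(x) + O(‖x‖^{r+s+2}) as x → 0, where DF_{r+1}(x) denotes the Jacobian matrix of F_{r+1} at x. In particular, if F∘G = G∘F near 0 then DF_{r+1}(x)·G_{s+1}(x) = DG_{s+1}(x)·F_{r+1}(x) identically, and in general the commutator F∘G∘F^{-1}∘G^{-1} is tangent to the identity to order r+s+1. -/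

import Mathlib

open Filter Topology Asymptotics

/-- `P : ℂⁿ → ℂⁿ` is a homogeneous polynomial map of degree `d`. -/
def IsHomogPolyMap (n d : ℕ) (P : (Fin n → ℂ) → (Fin n → ℂ)) : Prop :=
  ∀ i, ∃ q : MvPolynomial (Fin n) ℂ, q.IsHomogeneous d ∧ ∀ x, P x i = MvPolynomial.eval x q

section helpers

variable {E V : Type*} [NormedAddCommGroup E] [NormedSpace ℂ E]
  [NormedAddCommGroup V] [NormedSpace ℂ V] [CompleteSpace V]

/-- Cauchy estimate: the derivative of an analytic `O(‖x‖^(m+1))` map is `O(‖x‖^m)`. -/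
lemma fderiv_isBigO {φ : E → V} {m : ℕ} (ha : AnalyticAt ℂ φ 0)
    (hO : φ =O[𝓝 (0 : E)] fun x => ‖x‖ ^ (m + 1)) :
    (fderiv ℂ φ) =O[𝓝 (0 : E)] fun x => ‖x‖ ^ m := by
  obtain ⟨C, hC, hb⟩ := hO.exists_pos
  obtain ⟨δ, hδ, hball⟩ := Metric.eventually_nhds_iff.1 (hb.bound.and ha.eventually_analyticAt)
  have key : ∀ ρ : ℝ, 0 < ρ → ρ < δ / 2 → ∀ x : E, ‖x‖ ≤ ρ →
      ‖fderiv ℂ φ x‖ ≤ 2 * C * 2 ^ (m + 1) * ρ ^ m := by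
    intro ρ hρ hρδ x hx
    have hin : ∀ y ∈ Metric.ball x ρ, ‖y‖ < 2 * ρ := by
      intro y hy
      have h1 : ‖y - x‖ < ρ := by simpa [dist_eq_norm] using hy
      have h2 : ‖y‖ ≤ ‖y - x‖ + ‖x‖ := by simpa using norm_add_le (y - x) x
      linarith
    have hbd : ∀ y ∈ Metric.ball x ρ, ‖φ y‖ ≤ C * (2 * ρ) ^ (m + 1) := by
      intro y hy
      have h1 := hin y hy
      have h2 := (@hball y (by simp; linarith)).1
      rw [Real.norm_of_nonneg (by positivity)] at h2
      refine h2.trans ?_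
      gcongr
    have hd : DifferentiableOn ℂ φ (Metric.ball x ρ) := by
      intro y hy
      have h1 := hin y hy
      exact (@hball y (by simp; linarith)).2.differentiableAt.differentiableWithinAt
    have := Complex.norm_fderiv_le_div_of_mapsTo_ball (R₂ := 2 * (C * (2 * ρ) ^ (m + 1))) hd
      (by
        intro y hy
        rw [Metric.mem_closedBall, dist_eq_norm]
        have h1 := hbd y hy
        have h2 := hbd x (Metric.mem_ball_self hρ)
        have h3 := norm_sub_le (φ y) (φ x)
        linarith) hρ
    refine this.trans (le_of_eq ?_)
    field_simp
    ring
  refine IsBigO.of_bound (2 * C * 2 ^ (m + 1)) ?_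
  filter_upwards [Metric.ball_mem_nhds (0 : E) (half_pos hδ)] with x hx
  have hx' : ‖x‖ < δ / 2 := by simpa using hx
  rw [Real.norm_of_nonneg (by positivity)]
  have ht : Tendsto (fun ρ : ℝ => 2 * C * 2 ^ (m + 1) * ρ ^ m) (𝓝[>] ‖x‖)
      (𝓝 (2 * C * 2 ^ (m + 1) * ‖x‖ ^ m)) :=
    (Continuous.tendsto (by fun_prop) _).mono_left nhdsWithin_le_nhds
  refine ge_of_tendsto ht ?_
  filter_upwards [Ioo_mem_nhdsGT hx'] with ρ hρ
  exact key ρ ((norm_nonneg x).trans_lt hρ.1) hρ.2 x hρ.1.le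

lemma lip_of_isBigO {φ : E → V} {m : ℕ} (ha : AnalyticAt ℂ φ 0)
    (hO : φ =O[𝓝 (0 : E)] fun x => ‖x‖ ^ (m + 1)) :
    ∃ C : ℝ, 0 < C ∧ ∃ δ : ℝ, 0 < δ ∧ ∀ ρ < δ, ∀ x y : E, ‖x‖ ≤ ρ → ‖y‖ ≤ ρ →
      ‖φ y - φ x‖ ≤ C * ρ ^ m * ‖y - x‖ := by
  obtain ⟨C, hC, hb⟩ := (fderiv_isBigO ha hO).exists_pos
  obtain ⟨δ, hδ, hball⟩ := Metric.eventually_nhds_iff.1 (hb.bound.and ha.eventually_analyticAt)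
  refine ⟨C, hC, δ, hδ, fun ρ hρ x y hx hy => ?_⟩
  let : NormedSpace ℝ E := NormedSpace.restrictScalars ℝ ℂ E
  refine Convex.norm_image_sub_le_of_norm_fderiv_le (𝕜 := ℂ) (s := Metric.closedBall (0 : E) ρ)
    ?_ ?_ (convex_closedBall _ _) (by simpa using hx) (by simpa using hy)
  · intro z hz
    have hz' : ‖z‖ ≤ ρ := by simpa using hz
    exact (@hball z (by simp; linarith)).2.differentiableAt
  · intro z hz
    have hz' : ‖z‖ ≤ ρ := by simpa using hz
    have h2 := (@hball z (by simp; linarith)).1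
    rw [Real.norm_of_nonneg (by positivity)] at h2
    refine h2.trans ?_
    gcongr

lemma taylor_of_isBigO {φ : E → V} {m : ℕ} (ha : AnalyticAt ℂ φ 0)
    (hO : φ =O[𝓝 (0 : E)] fun x => ‖x‖ ^ (m + 2)) :
    ∃ C : ℝ, 0 < C ∧ ∃ δ : ℝ, 0 < δ ∧ ∀ ρ < δ, ∀ x y : E, ‖x‖ ≤ ρ → ‖y‖ ≤ ρ →
      ‖φ y - φ x - fderiv ℂ φ x (y - x)‖ ≤ C * ρ ^ m * ‖y - x‖ * ‖y - x‖ := by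
  obtain ⟨C, hC, δ₁, hδ₁, hlip⟩ := lip_of_isBigO ha.fderiv (fderiv_isBigO (m := m + 1) ha hO)
  obtain ⟨δ₂, hδ₂, hball⟩ := Metric.eventually_nhds_iff.1 ha.eventually_analyticAt
  refine ⟨C, hC, min δ₁ δ₂, lt_min hδ₁ hδ₂, fun ρ hρ x y hx hy => ?_⟩
  have hρ1 := hρ.trans_le (min_le_left _ _)
  have hρ2 := hρ.trans_le (min_le_right _ _)
  have hρ0 : 0 ≤ ρ := (norm_nonneg x).trans hx
  let : NormedSpace ℝ E := NormedSpace.restrictScalars ℝ ℂ E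
  have hseg : ∀ z ∈ segment ℝ x y, ‖z‖ ≤ ρ := by
    intro z hz
    have := (convex_closedBall (0 : E) ρ).segment_subset (x := x) (y := y)
      (by simpa using hx) (by simpa using hy) hz
    simpa using this
  refine Convex.norm_image_sub_le_of_norm_fderiv_le' (𝕜 := ℂ) (s := segment ℝ x y)
    ?_ ?_ (convex_segment _ _) (left_mem_segment _ _ _) (right_mem_segment _ _ _)
  · intro z hz
    have hz' := hseg z hz
    exact (@hball z (by simp; linarith)).differentiableAt
  · intro z hz
    refine (hlip ρ hρ1 x z hx (hseg z hz)).trans ?_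
    have : ‖z - x‖ ≤ ‖y - x‖ := norm_sub_le_of_mem_segment hz
    gcongr

lemma half_estimate {f P g Q : E → E} [CompleteSpace E] {r s : ℕ} (hr : 1 ≤ r) (hs : 1 ≤ s)
    (hfa : AnalyticAt ℂ f 0) (hPa : AnalyticAt ℂ P 0)
    (hP : P =O[𝓝 (0 : E)] fun x => ‖x‖ ^ (r + 1))
    (hQ : Q =O[𝓝 (0 : E)] fun x => ‖x‖ ^ (s + 1))
    (hf : (fun x => f x - P x) =O[𝓝 (0 : E)] fun x => ‖x‖ ^ (r + 2))
    (hg : (fun x => g x - Q x) =O[𝓝 (0 : E)] fun x => ‖x‖ ^ (s + 2)) :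
    (fun x => f (x + g x) - f x - fderiv ℂ P x (Q x))
      =O[𝓝 (0 : E)] fun x => ‖x‖ ^ (r + s + 2) := by
  obtain ⟨k, rfl⟩ : ∃ k, r = k + 1 := ⟨r - 1, by omega⟩
  obtain ⟨l, rfl⟩ : ∃ l, s = l + 1 := ⟨s - 1, by omega⟩
  have pow_mono : ∀ {a b : ℕ}, a ≤ b →
      (fun x : E => ‖x‖ ^ b) =O[𝓝 (0 : E)] fun x => ‖x‖ ^ a := by
    intro a b hab
    refine IsBigO.of_bound 1 ?_
    filter_upwards [Metric.ball_mem_nhds (0 : E) one_pos] with x hx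
    have hx' : ‖x‖ < 1 := by simpa using hx
    rw [Real.norm_of_nonneg (by positivity), Real.norm_of_nonneg (by positivity), one_mul]
    exact pow_le_pow_of_le_one (norm_nonneg x) hx'.le hab
  have hgO : g =O[𝓝 (0 : E)] fun x => ‖x‖ ^ (l + 2) := by
    simpa using (hg.trans (pow_mono (by omega))).add hQ
  have hgle : ∀ᶠ x in 𝓝 (0 : E), ‖g x‖ ≤ ‖x‖ := by
    have h1 : (fun x : E => ‖x‖ ^ 2) =o[𝓝 (0 : E)] fun x => ‖x‖ ^ 1 :=
      isLittleO_norm_pow_norm_pow one_lt_two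
    have h2 := ((hgO.trans (pow_mono (a := 2) (by omega))).trans_isLittleO h1).bound one_pos
    filter_upwards [h2] with x hx
    simpa using hx
  -- remainder part
  have hRa : AnalyticAt ℂ (fun x => f x - P x) 0 := hfa.sub hPa
  obtain ⟨C₁, hC₁, δ₁, hδ₁, hl⟩ := lip_of_isBigO (m := k + 2) hRa hf
  obtain ⟨C₂, hC₂, δ₂, hδ₂, ht⟩ := taylor_of_isBigO (m := k) hPa hP
  have small : ∀ δ > 0, ∀ᶠ x in 𝓝 (0 : E), 2 * ‖x‖ < δ := by
    intro δ hδ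
    filter_upwards [Metric.ball_mem_nhds (0 : E) (half_pos hδ)] with x hx
    have hx' : ‖x‖ < δ / 2 := by simpa using hx
    linarith
  have A : (fun x => (f (x + g x) - P (x + g x)) - (f x - P x))
      =O[𝓝 (0 : E)] fun x => ‖x‖ ^ (k + 2) * ‖g x‖ := by
    refine IsBigO.of_bound (C₁ * 2 ^ (k + 2)) ?_
    filter_upwards [hgle, small δ₁ hδ₁] with x hx hxs
    have h1 : ‖x + g x‖ ≤ 2 * ‖x‖ := (norm_add_le _ _).trans (by linarith)
    have := hl (2 * ‖x‖) hxs x (x + g x) (by linarith [norm_nonneg x]) h1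
    rw [Real.norm_of_nonneg (by positivity)]
    refine this.trans (le_of_eq ?_)
    rw [add_sub_cancel_left]
    ring
  have B : (fun x => P (x + g x) - P x - fderiv ℂ P x (g x))
      =O[𝓝 (0 : E)] fun x => ‖x‖ ^ k * ‖g x‖ * ‖g x‖ := by
    refine IsBigO.of_bound (C₂ * 2 ^ k) ?_
    filter_upwards [hgle, small δ₂ hδ₂] with x hx hxs
    have h1 : ‖x + g x‖ ≤ 2 * ‖x‖ := (norm_add_le _ _).trans (by linarith)
    have := ht (2 * ‖x‖) hxs x (x + g x) (by linarith [norm_nonneg x]) h1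
    rw [add_sub_cancel_left] at this
    rw [Real.norm_of_nonneg (by positivity)]
    refine this.trans (le_of_eq ?_)
    ring
  have D : (fun x => fderiv ℂ P x (g x - Q x))
      =O[𝓝 (0 : E)] fun x => ‖x‖ ^ (k + 1) * ‖x‖ ^ (l + 1 + 2) := by
    have h1 := fderiv_isBigO (m := k + 1) hPa hP
    refine IsBigO.trans (g := fun x => ‖fderiv ℂ P x‖ * ‖g x - Q x‖) ?_
      (h1.norm_left.mul hg.norm_left)
    refine IsBigO.of_bound 1 (Eventually.of_forall fun x => ?_)
    rw [Real.norm_of_nonneg (by positivity), one_mul]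
    exact ContinuousLinearMap.le_opNorm _ _
  have A' := A.trans ((isBigO_refl (fun x : E => ‖x‖ ^ (k + 2)) (𝓝 0)).mul hgO.norm_left)
  have B' := B.trans (((isBigO_refl (fun x : E => ‖x‖ ^ k) (𝓝 0)).mul hgO.norm_left).mul
    hgO.norm_left)
  simp only [← pow_add] at A' B' D
  have A'' := A'.trans (pow_mono (a := k + 1 + (l + 1) + 2) (by omega))
  have B'' := B'.trans (pow_mono (a := k + 1 + (l + 1) + 2) (by omega))
  have D'' := D.trans (pow_mono (a := k + 1 + (l + 1) + 2) (by omega))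
  refine ((A''.add B'').add D'').congr_left fun x => ?_
  rw [map_sub]
  abel

end helpers

lemma IsHomogPolyMap.analyticAt {n d : ℕ} {P : (Fin n → ℂ) → (Fin n → ℂ)}
    (h : IsHomogPolyMap n d P) (x : Fin n → ℂ) : AnalyticAt ℂ P x := by
  rw [analyticAt_pi_iff]
  intro i
  obtain ⟨q, -, hq⟩ := h i
  have h1 : AnalyticAt ℂ (fun x : Fin n → ℂ => MvPolynomial.aeval (fun j => x j) q) x :=
    AnalyticAt.aeval_mvPolynomial (fun j => (ContinuousLinearMap.proj (R := ℂ)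
      (φ := fun _ : Fin n => ℂ) j).analyticAt x) q
  have h2 : (fun x => P x i) = fun x : Fin n → ℂ => MvPolynomial.aeval (fun j => x j) q := by
    funext x
    rw [hq, MvPolynomial.aeval_eq_eval]
  rw [h2]
  exact h1

lemma IsHomogPolyMap.isBigO {n d : ℕ} {P : (Fin n → ℂ) → (Fin n → ℂ)}
    (h : IsHomogPolyMap n d P) : P =O[𝓝 (0 : Fin n → ℂ)] fun x => ‖x‖ ^ d := by
  rw [isBigO_pi]
  intro i
  obtain ⟨q, hd, hq⟩ := h i
  simp only [hq, MvPolynomial.eval_eq]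
  refine IsBigO.fun_sum (E' := ℂ) fun m hm => ?_
  refine IsBigO.of_bound ‖q.coeff m‖ (Eventually.of_forall fun x => ?_)
  rw [norm_mul, norm_prod, Real.norm_of_nonneg (by positivity),
    hd.degree_eq_sum_deg_support hm, ← Finset.prod_pow_eq_pow_sum]
  gcongr with j
  rw [norm_pow]
  gcongr
  exact norm_le_pi_norm x j

lemma IsHomogPolyMap.smul {n d : ℕ} {P : (Fin n → ℂ) → (Fin n → ℂ)}
    (h : IsHomogPolyMap n d P) (t : ℂ) (x : Fin n → ℂ) : P (t • x) = t ^ d • P x := by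
  funext i
  obtain ⟨q, hd, hq⟩ := h i
  simp only [hq, MvPolynomial.eval_eq, Pi.smul_apply, smul_eq_mul, Finset.mul_sum]
  refine Finset.sum_congr rfl fun m hm => ?_
  simp only [mul_pow, Finset.prod_mul_distrib]
  rw [hd.degree_eq_sum_deg_support hm, ← Finset.prod_pow_eq_pow_sum]
  ring

lemma IsHomogPolyMap.fderiv_smul {n d : ℕ} {P : (Fin n → ℂ) → (Fin n → ℂ)}
    (h : IsHomogPolyMap n (d + 1) P) (t : ℂ) (ht : t ≠ 0) (x : Fin n → ℂ) :
    fderiv ℂ P (t • x) = t ^ d • fderiv ℂ P x := by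
  have h1 : (fun x => P (t • x)) = t ^ (d + 1) • P := by
    funext x
    exact h.smul t x
  have h2 := fderiv_comp_smul (𝕜 := ℂ) (f := P) (x := x) t
  rw [h1, fderiv_const_smul_field] at h2
  have h3 : t • (t ^ d • fderiv ℂ P x) = t • fderiv ℂ P (t • x) := by
    rw [← h2, smul_smul, pow_succ']
    rfl
  exact (smul_right_injective _ ht h3).symm

/-- For `F(x) = x + F_{r+1}(x) + O(‖x‖^{r+2})` and `G(x) = x + G_{s+1}(x) + O(‖x‖^{s+2})`:
`F∘G − G∘F = DF_{r+1}·G_{s+1} − DG_{s+1}·F_{r+1} + O(‖x‖^{r+s+2})`; if `F` and `G` commute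
near `0` then `DF_{r+1}(x)·G_{s+1}(x) = DG_{s+1}(x)·F_{r+1}(x)` identically; and the
commutator `F∘G∘F⁻¹∘G⁻¹` is tangent to the identity to order `r+s+1`. -/
theorem commutator_estimate (n r s : ℕ) (hn : 1 ≤ n) (hr : 1 ≤ r) (hs : 1 ≤ s)
    (F G Fr Gs : (Fin n → ℂ) → (Fin n → ℂ))
    (hFa : AnalyticAt ℂ F 0) (hGa : AnalyticAt ℂ G 0)
    (hFr : IsHomogPolyMap n (r + 1) Fr) (hGs : IsHomogPolyMap n (s + 1) Gs)
    (hFexp : (fun x => F x - x - Fr x) =O[𝓝 (0 : Fin n → ℂ)] fun x => ‖x‖ ^ (r + 2))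
    (hGexp : (fun x => G x - x - Gs x) =O[𝓝 (0 : Fin n → ℂ)] fun x => ‖x‖ ^ (s + 2)) :
    ((fun x => F (G x) - G (F x) - (fderiv ℂ Fr x (Gs x) - fderiv ℂ Gs x (Fr x)))
        =O[𝓝 (0 : Fin n → ℂ)] fun x => ‖x‖ ^ (r + s + 2)) ∧
    ((F ∘ G =ᶠ[𝓝 (0 : Fin n → ℂ)] G ∘ F) →
        ∀ x, fderiv ℂ Fr x (Gs x) = fderiv ℂ Gs x (Fr x)) ∧
    (∀ F' G' : (Fin n → ℂ) → (Fin n → ℂ),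
        AnalyticAt ℂ F' 0 → AnalyticAt ℂ G' 0 → F' 0 = 0 → G' 0 = 0 →
        F ∘ F' =ᶠ[𝓝 (0 : Fin n → ℂ)] id → F' ∘ F =ᶠ[𝓝 (0 : Fin n → ℂ)] id →
        G ∘ G' =ᶠ[𝓝 (0 : Fin n → ℂ)] id → G' ∘ G =ᶠ[𝓝 (0 : Fin n → ℂ)] id →
        (fun x => F (G (F' (G' x))) - x) =O[𝓝 (0 : Fin n → ℂ)] fun x => ‖x‖ ^ (r + s + 1)) := by
  have hFO := hFr.isBigO
  have hGO := hGs.isBigO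
  have hFra := hFr.analyticAt 0
  have hGsa := hGs.analyticAt 0
  have e1 := half_estimate (f := fun x => F x - x) (g := fun x => G x - x) hr hs
    (hFa.sub analyticAt_id) hFra hFO hGO hFexp hGexp
  have e2 := half_estimate (f := fun x => G x - x) (g := fun x => F x - x) hs hr
    (hGa.sub analyticAt_id) hGsa hGO hFO hGexp hFexp
  rw [add_comm s r] at e2
  have main : (fun x => F (G x) - G (F x) - (fderiv ℂ Fr x (Gs x) - fderiv ℂ Gs x (Fr x)))
        =O[𝓝 (0 : Fin n → ℂ)] fun x => ‖x‖ ^ (r + s + 2) := by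
    refine (e1.sub e2).congr_left fun x => ?_
    simp only [add_sub_cancel]
    abel
  have hfd : ∀ {a b : ℕ} {P Q : (Fin n → ℂ) → (Fin n → ℂ)}, IsHomogPolyMap n (a + 1) P →
      IsHomogPolyMap n (b + 1) Q →
      (fun x => fderiv ℂ P x (Q x)) =O[𝓝 (0 : Fin n → ℂ)] fun x => ‖x‖ ^ (a + b + 1) := by
    intro a b P Q hP hQ
    have h1 := fderiv_isBigO (hP.analyticAt 0) hP.isBigO
    have h2 : (fun x => fderiv ℂ P x (Q x)) =O[𝓝 (0 : Fin n → ℂ)]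
        fun x => ‖x‖ ^ a * ‖x‖ ^ (b + 1) := by
      refine IsBigO.trans (g := fun x => ‖fderiv ℂ P x‖ * ‖Q x‖) ?_
        (h1.norm_left.mul hQ.isBigO.norm_left)
      refine IsBigO.of_bound 1 (Eventually.of_forall fun x => ?_)
      rw [Real.norm_of_nonneg (by positivity), one_mul]
      exact ContinuousLinearMap.le_opNorm _ _
    simpa only [← pow_add, ← add_assoc] using h2
  refine ⟨main, ?_, ?_⟩
  · intro hcomm x
    set H : (Fin n → ℂ) → (Fin n → ℂ) := fun x => fderiv ℂ Fr x (Gs x) - fderiv ℂ Gs x (Fr x)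
      with hH
    have hHO : H =O[𝓝 (0 : Fin n → ℂ)] fun x => ‖x‖ ^ (r + s + 2) := by
      refine main.neg_left.congr' ?_ EventuallyEq.rfl
      filter_upwards [hcomm] with y hy
      have hy' : F (G y) = G (F y) := hy
      simp [hH, hy']
    have hsm : ∀ t : ℂ, t ≠ 0 → H (t • x) = t ^ (r + s + 1) • H x := by
      intro t ht
      simp only [hH, hFr.fderiv_smul t ht, hGs.fderiv_smul t ht, hFr.smul, hGs.smul, map_smul,
        smul_apply, smul_smul, smul_sub]
      congr 2 <;> ring
    suffices hx : H x = 0 from sub_eq_zero.1 hx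
    obtain ⟨C, hC, hb⟩ := hHO.exists_pos
    have htend : Tendsto (fun t : ℝ => (t : ℂ) • x) (𝓝[>] 0) (𝓝 0) := by
      have : Continuous fun t : ℝ => (t : ℂ) • x := by fun_prop
      simpa using (this.tendsto 0).mono_left nhdsWithin_le_nhds
    have hle : ∀ᶠ t : ℝ in 𝓝[>] 0, ‖H x‖ ≤ C * ‖x‖ ^ (r + s + 2) * t := by
      filter_upwards [htend.eventually hb.bound, self_mem_nhdsWithin] with t ht ht0
      have ht0' : (0 : ℝ) < t := ht0
      rw [hsm t (by exact_mod_cast ht0'.ne'), norm_smul, norm_pow, norm_smul,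
        Real.norm_of_nonneg (by positivity), Complex.norm_real, Real.norm_of_nonneg ht0'.le] at ht
      refine le_of_mul_le_mul_left (ht.trans (le_of_eq ?_)) (pow_pos ht0' (r + s + 1))
      ring
    have hlim : Tendsto (fun t : ℝ => C * ‖x‖ ^ (r + s + 2) * t) (𝓝[>] 0) (𝓝 0) := by
      have : Continuous fun t : ℝ => C * ‖x‖ ^ (r + s + 2) * t := by fun_prop
      simpa using (this.tendsto 0).mono_left nhdsWithin_le_nhds
    exact norm_le_zero_iff.1 (ge_of_tendsto hlim hle)
  · intro F' G' hF'a hG'a hF'0 hG'0 hFF' _ hGG' _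
    have hH2 := hfd hGs hFr
    rw [add_comm s r] at hH2
    have hO : (fun x => F (G x) - G (F x)) =O[𝓝 (0 : Fin n → ℂ)]
        fun x => ‖x‖ ^ (r + s + 1) := by
      have h1 : (fun x : Fin n → ℂ => ‖x‖ ^ (r + s + 2)) =O[𝓝 (0 : Fin n → ℂ)]
          fun x => ‖x‖ ^ (r + s + 1) :=
        (isLittleO_norm_pow_norm_pow (by omega)).isBigO
      refine ((main.trans h1).add ((hfd hFr hGs).sub hH2)).congr_left fun x => ?_
      abel
    have hG't : Tendsto G' (𝓝 0) (𝓝 0) := by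
      simpa [hG'0] using hG'a.continuousAt.tendsto
    have hF't : Tendsto F' (𝓝 0) (𝓝 0) := by
      simpa [hF'0] using hF'a.continuousAt.tendsto
    have hy : (fun x => F' (G' x)) =O[𝓝 (0 : Fin n → ℂ)] fun x => x := by
      have a1 : F' =O[𝓝 0] fun x => x := by
        simpa [hF'0] using hF'a.differentiableAt.isBigO_sub
      have a2 : G' =O[𝓝 0] fun x => x := by
        simpa [hG'0] using hG'a.differentiableAt.isBigO_sub
      exact (a1.comp_tendsto hG't).trans a2
    have h3 := (hO.comp_tendsto (hF't.comp hG't)).trans (hy.norm_norm.pow (r + s + 1))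
    refine h3.congr' ?_ EventuallyEq.rfl
    filter_upwards [hG't.eventually hFF', hGG'] with x hx1 hx2
    simp only [Function.comp_apply, id] at hx1 hx2 ⊢
    rw [hx1, hx2]
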